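/- arXiv:1903.10697 — 4 statements merged into one kernel-verified Lean document; each statement's English description precedes it below -/
import Mathlib

section
/- Let d : ℤ → ℕ be a finitely supported function with d(1) = 0 and Σ_{k ∈ ℤ} (k − 1)·d(k) = −1, and let N = Σ_{k ∈ ℤ} d(k). Then the number of generalized Łukasiewicz words l = (l_1, …, l_N) in which each integer k occurs exactly d(k) times is equal to (1/N)·N!/∏_{k ∈ ℤ} d(k)!, i.e. equal to (N − 1)!/∏_{k ∈ ℤ} d(k)!. -/
/-- A generalized Łukasiewicz word: a nonempty finite sequence of integers, none equal
to 1, whose partial sums of `l_i - 1` are nonnegative for proper prefixes and whose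
total sum of `l_i - 1` equals `-1`. -/
def IsGenLuk (l : List ℤ) : Prop :=
  l ≠ [] ∧ (∀ x ∈ l, x ≠ 1) ∧
  (∀ n : ℕ, 1 ≤ n → n < l.length → 0 ≤ (l.take n).sum - (n : ℤ)) ∧
  l.sum - (l.length : ℤ) = -1

/-- Among the first `N` values of an integer sequence there is exactly one leftmost minimum. -/
theorem existsUnique_leftmost_min (S : ℕ → ℤ) {N : ℕ} (hN : 0 < N) :
    ∃! j, j < N ∧ (∀ i, j < i → i < N → S j ≤ S i) ∧ ∀ i < j, S j < S i := by
  classical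
  obtain ⟨k, hk, hmin⟩ := (Finset.range N).exists_min_image S ⟨0, Finset.mem_range.2 hN⟩
  have hex : ∃ j, j < N ∧ ∀ i < N, S j ≤ S i :=
    ⟨k, Finset.mem_range.1 hk, fun i hi => hmin i (Finset.mem_range.2 hi)⟩
  refine ⟨Nat.find hex, ⟨(Nat.find_spec hex).1, fun i _ hi => (Nat.find_spec hex).2 i hi, ?_⟩, ?_⟩
  · intro i hi
    by_contra! hle
    exact Nat.find_min hex hi ⟨hi.trans (Nat.find_spec hex).1,
      fun n hn => hle.trans ((Nat.find_spec hex).2 n hn)⟩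
  · rintro j ⟨hjN, hright, hleft⟩
    obtain ⟨hfN, hf⟩ := Nat.find_spec hex
    rcases lt_trichotomy j (Nat.find hex) with h | h | h
    · refine absurd ⟨hjN, fun i hi => ?_⟩ (Nat.find_min hex h)
      exact (hright _ h hfN).trans (hf i hi)
    · exact h
    · exact absurd (hf j hjN) (hleft _ h).not_ge

/-- The height of the lattice path with steps `l_i - 1` after `n` steps. -/
def lukHeight (l : List ℤ) (n : ℕ) : ℤ := (l.take n).sum - n

theorem lukHeight_rotate_of_le {l : List ℤ} {j n : ℕ} (h : j + n ≤ l.length) :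
    lukHeight (l.rotate j) n = lukHeight l (j + n) - lukHeight l j := by
  rw [lukHeight, lukHeight, lukHeight, List.rotate_eq_drop_append_take (by omega),
    List.take_append_of_le_length (by simp; omega), List.take_add, List.sum_append]
  push_cast
  ring

theorem lukHeight_rotate_of_ge {l : List ℤ} {j i : ℕ} (hj : j ≤ l.length) (hi : i ≤ j) :
    lukHeight (l.rotate j) (l.length - j + i) =
      l.sum - l.length + lukHeight l i - lukHeight l j := by
  have hdrop : (l.drop j).length = l.length - j := by simp
  have hsum : (l.take j).sum + (l.drop j).sum = l.sum := by
    rw [← List.sum_append, List.take_append_drop]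
  rw [lukHeight, lukHeight, lukHeight, List.rotate_eq_drop_append_take hj, ← hdrop,
    List.take_length_add_append, List.sum_append, List.take_take, min_eq_left hi, hdrop]
  push_cast [Nat.cast_sub hj]
  linarith

theorem isGenLuk_rotate_iff {l : List ℤ} (hne : l ≠ []) (hone : ∀ x ∈ l, x ≠ 1)
    (hsum : l.sum - (l.length : ℤ) = -1) {j : ℕ} (hj : j < l.length) :
    IsGenLuk (l.rotate j) ↔
      (∀ i, j < i → i < l.length → lukHeight l j ≤ lukHeight l i) ∧
        ∀ i < j, lukHeight l j < lukHeight l i := by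
  have hgen : IsGenLuk (l.rotate j) ↔
      ∀ n, 1 ≤ n → n < l.length → 0 ≤ lukHeight (l.rotate j) n := by
    have hs : (l.rotate j).sum = l.sum := (List.rotate_perm l j).sum_eq
    simp only [IsGenLuk, List.length_rotate, List.mem_rotate, ne_eq, List.rotate_eq_nil_iff, hs,
      lukHeight]
    exact ⟨fun h => h.2.2.1, fun h => ⟨hne, hone, h, hsum⟩⟩
  rw [hgen]
  constructor
  · intro h
    refine ⟨fun i hji hi => ?_, fun i hi => ?_⟩
    · have := h (i - j) (by omega) (by omega)
      rw [lukHeight_rotate_of_le (by omega), Nat.add_sub_cancel' hji.le] at this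
      linarith
    · have := h (l.length - j + i) (by omega) (by omega)
      rw [lukHeight_rotate_of_ge hj.le hi.le, hsum] at this
      linarith
  · rintro ⟨hright, hleft⟩ n hn hnl
    rcases lt_or_ge (j + n) l.length with h | h
    · rw [lukHeight_rotate_of_le h.le]
      linarith [hright (j + n) (by omega) h]
    · obtain ⟨i, rfl⟩ := Nat.exists_eq_add_of_le (show l.length - j ≤ n by omega)
      rw [lukHeight_rotate_of_ge hj.le (by omega), hsum]
      linarith [hleft i (by omega)]

/-- The cycle lemma: exactly one cyclic shift is a generalized Łukasiewicz word. -/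
theorem existsUnique_isGenLuk_rotate {l : List ℤ} (hne : l ≠ []) (hone : ∀ x ∈ l, x ≠ 1)
    (hsum : l.sum - (l.length : ℤ) = -1) :
    ∃! j, j < l.length ∧ IsGenLuk (l.rotate j) := by
  have h := existsUnique_leftmost_min (lukHeight l) (List.length_pos_iff.2 hne)
  refine (existsUnique_congr fun j => and_congr_right fun hj => ?_).2 h
  exact isGenLuk_rotate_iff hne hone hsum hj

/-- The finite set of words whose multiset of letters is `m`. -/
def Multiset.words {α : Type*} [DecidableEq α] (m : Multiset α) : Finset (List α) :=
  m.lists.toFinset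

theorem Multiset.mem_words {α : Type*} [DecidableEq α] {m : Multiset α} {l : List α} :
    l ∈ m.words ↔ (l : Multiset α) = m := by
  rw [words, Multiset.mem_toFinset, Multiset.mem_lists_iff, eq_comm]
  rfl

theorem Multiset.words_eq_biUnion {α : Type*} [DecidableEq α] {m : Multiset α} (hm : m ≠ 0) :
    m.words = m.toFinset.biUnion fun a => (m.erase a).words.image (List.cons a) := by
  ext l
  simp only [Finset.mem_biUnion, Finset.mem_image, Multiset.mem_toFinset, mem_words]
  constructor
  · rintro rfl
    cases l with
    | nil => simp at hm
    | cons a t => exact ⟨a, by simp, t, by simp, rfl⟩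
  · rintro ⟨a, ha, t, ht, rfl⟩
    rw [← Multiset.cons_coe, ht, Multiset.cons_erase ha]

theorem Multiset.card_words_eq_sum {α : Type*} [DecidableEq α] {m : Multiset α} (hm : m ≠ 0) :
    m.words.card = ∑ a ∈ m.toFinset, (m.erase a).words.card := by
  rw [words_eq_biUnion hm, Finset.card_biUnion]
  · exact Finset.sum_congr rfl fun a _ => Finset.card_image_of_injective _ List.cons_injective
  · intro a _ b _ hab
    rw [Function.onFun, Finset.disjoint_left]
    intro l hl hl'
    obtain ⟨s, -, rfl⟩ := Finset.mem_image.1 hl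
    obtain ⟨t, -, ht⟩ := Finset.mem_image.1 hl'
    exact hab (List.cons.inj ht).1.symm

theorem Multiset.card_words_mul_prod_factorial {α : Type*} [DecidableEq α] (s : Finset α)
    (m : Multiset α) (hs : m.toFinset ⊆ s) :
    m.words.card * ∏ a ∈ s, (m.count a).factorial = (Multiset.card m).factorial := by
  induction hn : Multiset.card m generalizing m with
  | zero =>
    obtain rfl := Multiset.card_eq_zero.1 hn
    have : (0 : Multiset α).words = {[]} := by
      ext l
      simp [mem_words]
    simp [this]
  | succ n ih =>
    have hm : m ≠ 0 := by
      rintro rfl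
      simp at hn
    rw [card_words_eq_sum hm, Finset.sum_mul]
    have hterm : ∀ a ∈ m.toFinset, (m.erase a).words.card * ∏ b ∈ s, (m.count b).factorial =
        m.count a * n.factorial := by
      intro a ha
      have ham : a ∈ m := Multiset.mem_toFinset.1 ha
      have hcount : m.count a = (m.erase a).count a + 1 := by
        rw [Multiset.count_erase_self, Nat.sub_add_cancel (Multiset.count_pos.2 ham)]
      rw [← ih (m.erase a) ((Multiset.toFinset_subset.2 (Multiset.erase_subset a m)).trans hs)
          (by rw [Multiset.card_erase_of_mem ham, hn]; rfl),
        ← Finset.mul_prod_erase s _ (hs ha), ← Finset.mul_prod_erase s _ (hs ha), hcount,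
        Nat.factorial_succ]
      rw [Finset.prod_congr rfl fun b hb => by
        rw [← Multiset.count_erase_of_ne (Finset.ne_of_mem_erase hb) m]]
      ring
    rw [Finset.sum_congr rfl hterm, ← Finset.sum_mul, Multiset.toFinset_sum_count_eq, hn,
      Nat.factorial_succ]

theorem List.rotate_surjective {α : Type*} (n : ℕ) :
    Function.Surjective fun l : List α => l.rotate n := by
  intro l
  rcases eq_or_ne l [] with rfl | hl
  · exact ⟨[], List.rotate_nil n⟩
  · refine ⟨l.rotate (l.length * n - n), ?_⟩
    have hle : n ≤ l.length * n := Nat.le_mul_of_pos_left n (List.length_pos_iff.2 hl)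
    simp only [List.rotate_rotate, Nat.sub_add_cancel hle, List.rotate_length_mul]

open Classical in
/-- Among the words with `n` prescribed letters, the generalized Łukasiewicz words make up exactly
one `n`-th. -/
theorem card_mul_card_filter_isGenLuk (m : Multiset ℤ) (hone : 1 ∉ m)
    (hsum : m.sum - (Multiset.card m : ℤ) = -1) :
    Multiset.card m * (m.words.filter IsGenLuk).card = m.words.card := by
  have hm : m ≠ 0 := by
    rintro rfl
    simp at hsum
  have hrot : ∀ j, (m.words.filter fun l => IsGenLuk (l.rotate j)).card =
      (m.words.filter IsGenLuk).card := by
    intro j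
    refine Finset.card_bij (fun l _ => l.rotate j) ?_ ?_ ?_
    · intro l hl
      rw [Finset.mem_filter, Multiset.mem_words] at hl ⊢
      exact ⟨(Multiset.coe_eq_coe.2 (l.rotate_perm j)).trans hl.1, hl.2⟩
    · exact fun _ _ _ _ h => List.rotate_injective j h
    · intro l hl
      rw [Finset.mem_filter, Multiset.mem_words] at hl
      obtain ⟨l', rfl⟩ := List.rotate_surjective j l
      refine ⟨l', ?_, rfl⟩
      rw [Finset.mem_filter, Multiset.mem_words]
      exact ⟨(Multiset.coe_eq_coe.2 (l'.rotate_perm j)).symm.trans hl.1, hl.2⟩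
  have huniq_shift : ∀ l ∈ m.words,
      ((Finset.range (Multiset.card m)).filter fun j => IsGenLuk (l.rotate j)).card = 1 := by
    intro l hl
    rw [Multiset.mem_words] at hl
    subst hl
    obtain ⟨j, hj, huniq⟩ := existsUnique_isGenLuk_rotate (l := l) (by simpa using hm)
      (fun x hx h => hone (by simpa [h] using hx)) (by simpa using hsum)
    refine Finset.card_eq_one.2 ⟨j, ?_⟩
    ext i
    simp only [Finset.mem_filter, Finset.mem_range, Finset.mem_singleton, Multiset.coe_card]
    exact ⟨fun h => huniq i h, fun h => h ▸ hj⟩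
  have hcomm := Finset.sum_card_bipartiteAbove_eq_sum_card_bipartiteBelow
    (s := m.words) (t := Finset.range (Multiset.card m)) (fun l j => IsGenLuk (l.rotate j))
  simp only [Finset.bipartiteAbove, Finset.bipartiteBelow] at hcomm
  rw [Finset.sum_congr rfl huniq_shift, Finset.sum_congr rfl fun j _ => hrot j] at hcomm
  simpa using hcomm.symm

theorem stmt_0 (d : ℤ →₀ ℕ) (hd1 : d 1 = 0)
    (hsum : ∑ k ∈ d.support, (k - 1) * (d k : ℤ) = -1)
    (N : ℕ) (hN : N = ∑ k ∈ d.support, d k) :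
    ({l : List ℤ | IsGenLuk l ∧ ∀ k : ℤ, l.count k = d k}.ncard : ℚ) =
      (Nat.factorial (N - 1) : ℚ) / (∏ k ∈ d.support, (Nat.factorial (d k) : ℚ)) := by
  classical
  set m : Multiset ℤ := Finsupp.toMultiset d with hm
  have hcard : Multiset.card m = N := by
    rw [hm, Finsupp.card_toMultiset, hN, Finsupp.sum]
    rfl
  have hmsum : m.sum - (Multiset.card m : ℤ) = -1 := by
    rw [hcard, hN, ← hsum, hm, Finsupp.sum_toMultiset, Finsupp.sum]
    push_cast
    rw [← Finset.sum_sub_distrib]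
    exact Finset.sum_congr rfl fun k _ => by rw [nsmul_eq_mul]; ring
  have hset : {l : List ℤ | IsGenLuk l ∧ ∀ k : ℤ, l.count k = d k} =
      ↑(m.words.filter IsGenLuk) := by
    ext l
    simp only [Set.mem_ofPred_eq, Finset.coe_filter, Multiset.mem_words, Multiset.ext,
      hm, Finsupp.count_toMultiset, Multiset.coe_count, and_comm]
  have hcycle := card_mul_card_filter_isGenLuk m
    (by rw [← Multiset.count_eq_zero, hm, Finsupp.count_toMultiset, hd1]) hmsum
  have hwords := Multiset.card_words_mul_prod_factorial d.support m
    (by rw [hm, Finsupp.toFinset_toMultiset])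
  have hpos : N ≠ 0 := by
    rintro rfl
    rw [Multiset.card_eq_zero] at hcard
    simp [hcard] at hmsum
  simp only [hm, Finsupp.count_toMultiset] at hwords
  rw [← hm, ← hcycle, hcard, ← Nat.mul_factorial_pred hpos, mul_assoc] at hwords
  have hcount := Nat.eq_of_mul_eq_mul_left (Nat.pos_of_ne_zero hpos) hwords
  rw [hset, Set.ncard_coe_finset, eq_div_iff (Finset.prod_ne_zero_iff.2 fun k _ =>
    Nat.cast_ne_zero.2 (Nat.factorial_ne_zero _))]
  exact_mod_cast hcount
end

section
/- Let l = (l_1, …, l_N) be a finite sequence of integers with N ≥ 1 and Σ_{i=1}^{N} (l_i − 1) = −1. Then the N cyclic rotations C(0; l), C(1; l), …, C(N−1; l) of l are pairwise distinct sequences. -/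
theorem Function.Periodic.sum_range_mul {M : Type*} [AddCommMonoid M] {f : ℕ → M} {c : ℕ}
    (hf : Function.Periodic f c) (n : ℕ) :
    ∑ k ∈ Finset.range (n * c), f k = n • ∑ k ∈ Finset.range c, f k := by
  induction n with
  | zero => simp
  | succ n ih =>
    rw [Nat.succ_mul, Finset.sum_range_add, ih, succ_nsmul]
    congr 1
    refine Finset.sum_congr rfl fun k _ => ?_
    rw [add_comm]
    exact hf.nat_mul n k

theorem List.sum_range_head?_rotate {M : Type*} [AddCommMonoid M] (l : List M) :
    ∑ n ∈ Finset.range l.length, (l.rotate n).head?.getD 0 = l.sum := by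
  rw [Finset.sum_range, ← Fin.sum_univ_getElem l]
  refine Finset.sum_congr rfl fun n _ => ?_
  simp [List.head?_rotate n.isLt]

/-- If a list of integers is fixed by rotation by `d`, then its length divides `d` times its
sum. -/
theorem List.length_dvd_mul_sum_of_rotate_eq_self {l : List ℤ} {d : ℕ} (h : l.rotate d = l) :
    (l.length : ℤ) ∣ d * l.sum := by
  let f : ℕ → ℤ := fun n => (l.rotate n).head?.getD 0
  have hd : Function.Periodic f d := fun n => by
    simp only [f]
    rw [add_comm, ← List.rotate_rotate, h]
  have hN : Function.Periodic f l.length := fun n => by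
    simp only [f]
    rw [add_comm, ← List.rotate_rotate, List.rotate_length]
  have key := hN.sum_range_mul d
  rw [mul_comm, hd.sum_range_mul, List.sum_range_head?_rotate, nsmul_eq_mul, nsmul_eq_mul] at key
  exact ⟨_, key.symm⟩

/-- The `i`-th cyclic rotation of a list `l = (l_1, …, l_N)` is
`C(i; l) = (l_{i+1}, …, l_N, l_1, …, l_i)`, which is `List.rotate l i`. -/
theorem stmt_1 (l : List ℤ) (hl : l ≠ [])
    (hsum : l.sum - (l.length : ℤ) = -1) :
    ∀ i j : ℕ, i < l.length → j < l.length → i ≠ j → l.rotate i ≠ l.rotate j := by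
  intro i j hi hj hij heq
  wlog hlt : i < j generalizing i j
  · exact this j i hj hi hij.symm heq.symm (by omega)
  have hrot : l.rotate (j - i) = l := by
    apply List.rotate_injective i
    simp only [List.rotate_rotate]
    rw [Nat.sub_add_cancel hlt.le, heq]
  obtain ⟨c, hc⟩ := List.length_dvd_mul_sum_of_rotate_eq_self hrot
  have hdvd : (l.length : ℤ) ∣ ((j - i : ℕ) : ℤ) :=
    ⟨((j - i : ℕ) : ℤ) - c, by linear_combination ((j - i : ℕ) : ℤ) * hsum - hc⟩
  have := Nat.le_of_dvd (by omega) (Int.natCast_dvd_natCast.mp hdvd)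
  omega
end

section
/- Let w = (w_1, …, w_N) be a finite sequence of integers with N ≥ 1 such that Σ_{r=1}^{n} (w_r − 1) ≥ 0 for every 1 ≤ n < N and Σ_{r=1}^{N} (w_r − 1) = −1. Then for every 1 ≤ j ≤ N − 1 the cyclic rotation C(j; w) fails this prefix-sum condition; that is, w itself is the only cyclic rotation of w satisfying it. -/
/-- If `w` satisfies the Łukasiewicz prefix-sum condition and total sum `-1`, then every
nontrivial cyclic rotation `C(j; w) = List.rotate w j`, `1 ≤ j ≤ N - 1`, fails the
prefix-sum condition; i.e. `w` is the only such rotation satisfying it. -/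
theorem stmt_3 (w : List ℤ) (hw : w ≠ [])
    (hpre : ∀ n : ℕ, 1 ≤ n → n < w.length → 0 ≤ (w.take n).sum - (n : ℤ))
    (hsum : w.sum - (w.length : ℤ) = -1) :
    ∀ j : ℕ, 1 ≤ j → j < w.length →
      ∃ n : ℕ, 1 ≤ n ∧ n < w.length ∧ ((w.rotate j).take n).sum - (n : ℤ) < 0 := by
  intro j hj hjN
  refine ⟨w.length - j, by omega, by omega, ?_⟩
  have htake : (w.rotate j).take (w.length - j) = w.drop j := by
    rw [List.rotate_eq_drop_append_take hjN.le]
    exact List.take_left' List.length_drop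
  have hsplit : (w.take j).sum + (w.drop j).sum = w.sum := List.sum_take_add_sum_drop w j
  have hj_nonneg := hpre j hj hjN
  rw [htake, Nat.cast_sub hjN.le]
  linarith
end

section
/- Fix integers n ≥ 2 and 1 ≤ j ≤ n. Let i_0, i_1, …, i_n be nonnegative integers satisfying Σ_{k ≠ j, 0 ≤ k ≤ n} i_k = i_j and Σ_{k ≠ j, 0 ≤ k ≤ n} k·i_k = j·i_j. Define the finitely supported function d : ℤ → ℕ by d(0) = i_{j−1} + 1, d(1 + k − j) = i_k for every k ∈ {0, 1, …, n} with k ≠ j and k ≠ j − 1, and d(t) = 0 for all other integers t. Then the number of generalized Łukasiewicz words whose degree sequence is d equals (1/(i_{j−1} + 1)) · i_j! / ∏_{k ≠ j, 0 ≤ k ≤ n} i_k!, i.e. it equals the coefficient (up to sign) of the corresponding monomial in Sturmfels' A-hypergeometric series [a_{j−1}/a_j]. -/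
section Arrangements

variable {α : Type*} [DecidableEq α]

/-- The finite set of all lists whose underlying multiset is `s`. -/
def Multiset.arrangements (s : Multiset α) : Finset (List α) :=
  s.lists.toFinset

theorem Multiset.mem_arrangements {s : Multiset α} {l : List α} :
    l ∈ s.arrangements ↔ (l : Multiset α) = s := by
  simp [Multiset.arrangements, eq_comm]

theorem Multiset.card_arrangements_eq_sum {s : Multiset α} (hs : s ≠ 0) :
    s.arrangements.card = ∑ a ∈ s.toFinset, (s.erase a).arrangements.card := by
  have h : s.arrangements = s.toFinset.biUnion
      fun a => (s.erase a).arrangements.map ⟨List.cons a, List.cons_injective⟩ := by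
    ext l
    simp only [Finset.mem_biUnion, Finset.mem_map, Multiset.mem_arrangements,
      Multiset.mem_toFinset, Function.Embedding.coeFn_mk]
    constructor
    · rintro rfl
      cases l with
      | nil => simp at hs
      | cons a l => exact ⟨a, by simp, l, by simp, rfl⟩
    · rintro ⟨a, ha, l, hl, rfl⟩
      rw [← Multiset.cons_coe, hl, Multiset.cons_erase ha]
  rw [h, Finset.card_biUnion]
  · simp
  · intro a _ b _ hab
    rw [Function.onFun, Finset.disjoint_left]
    intro l hla hlb
    simp only [Finset.mem_map, Function.Embedding.coeFn_mk] at hla hlb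
    obtain ⟨u, -, rfl⟩ := hla
    obtain ⟨v, -, hv⟩ := hlb
    exact hab (List.cons.inj hv).1.symm

theorem Multiset.card_arrangements_mul_prod_factorial {t : Finset α} {s : Multiset α}
    (hst : s.toFinset ⊆ t) :
    s.arrangements.card * ∏ a ∈ t, (s.count a).factorial = s.card.factorial := by
  induction hn : s.card generalizing s with
  | zero =>
    obtain rfl := Multiset.card_eq_zero.mp hn
    have h : (0 : Multiset α).arrangements = {[]} := by
      ext l
      simp [Multiset.mem_arrangements]
    simp [h]
  | succ n ih =>
    have hs : s ≠ 0 := by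
      rintro rfl
      simp at hn
    have key : ∀ a ∈ s.toFinset, (s.erase a).arrangements.card *
        ∏ b ∈ t, (s.count b).factorial = s.count a * n.factorial := by
      intro a ha
      have has := Multiset.mem_toFinset.mp ha
      have hsub : (s.erase a).toFinset ⊆ t :=
        (Multiset.toFinset_subset.mpr (Multiset.erase_subset a s)).trans hst
      rw [← ih hsub (by rw [Multiset.card_erase_of_mem has, hn]; rfl),
        ← Finset.mul_prod_erase t _ (hst ha), ← Finset.mul_prod_erase t _ (hst ha),
        Multiset.count_erase_self,
        ← Nat.mul_factorial_pred (Multiset.count_pos.mpr has).ne',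
        Finset.prod_congr rfl fun b hb => congrArg Nat.factorial
          (Multiset.count_erase_of_ne (Finset.ne_of_mem_erase hb) s)]
      ring
    rw [Multiset.card_arrangements_eq_sum hs, Finset.sum_mul, Finset.sum_congr rfl key,
      ← Finset.sum_mul, Multiset.toFinset_sum_count_eq, hn, Nat.factorial_succ]

end Arrangements

section CycleLemma

/-- All proper prefixes of `l` have a sum that is at least their length. -/
def PrefixNonneg (l : List ℤ) : Prop :=
  ∀ n < l.length, 0 ≤ (l.take n).sum - (n : ℤ)

theorem sum_take_rotate_of_add_le {l : List ℤ} {k n : ℕ} (h : k + n ≤ l.length) :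
    ((l.rotate k).take n).sum = (l.take (k + n)).sum - (l.take k).sum := by
  rw [List.rotate_eq_drop_append_take (by omega), List.take_append_of_le_length (by simp; omega),
    List.take_add, List.sum_append]
  ring

theorem sum_take_rotate_of_le_add {l : List ℤ} {k p : ℕ} (hk : k ≤ l.length) (hp : p ≤ k) :
    ((l.rotate k).take (l.length - k + p)).sum =
      l.sum - (l.take k).sum + (l.take p).sum := by
  rw [List.rotate_eq_drop_append_take hk, List.take_append, List.take_of_length_le (by simp),
    List.sum_append, List.take_take, List.length_drop, Nat.add_sub_cancel_left,
    min_eq_left hp, ← List.sum_take_add_sum_drop l k]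
  ring

theorem prefixNonneg_rotate_iff {l : List ℤ} (hl : l.sum - (l.length : ℤ) = -1) {k : ℕ}
    (hk : k < l.length) :
    PrefixNonneg (l.rotate k) ↔
      (∀ p, k ≤ p → p < l.length → (l.take k).sum - (k : ℤ) ≤ (l.take p).sum - (p : ℤ)) ∧
      ∀ p < k, (l.take k).sum - (k : ℤ) < (l.take p).sum - (p : ℤ) := by
  unfold PrefixNonneg
  rw [List.length_rotate]
  constructor
  · intro h
    constructor
    · intro p hkp hp
      obtain ⟨n, rfl⟩ := Nat.exists_eq_add_of_le hkp
      have := h n (by omega)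
      rw [sum_take_rotate_of_add_le hp.le] at this
      push_cast
      linarith
    · intro p hp
      have := h (l.length - k + p) (by omega)
      rw [sum_take_rotate_of_le_add hk.le hp.le] at this
      push_cast [Nat.cast_sub hk.le] at this
      linarith
  · rintro ⟨h, h'⟩ n hn
    rcases lt_or_ge (k + n) l.length with hkn | hkn
    · rw [sum_take_rotate_of_add_le hkn.le]
      have := h (k + n) (by omega) hkn
      push_cast at this
      linarith
    · obtain ⟨p, rfl⟩ := Nat.exists_eq_add_of_le (show l.length - k ≤ n by omega)
      rw [sum_take_rotate_of_le_add hk.le (by omega)]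
      have := h' p (by omega)
      push_cast [Nat.cast_sub hk.le]
      linarith

/-- The cycle lemma: exactly one rotation of an integer word with total excess `-1` has
nonnegative excess on all proper prefixes. -/
theorem existsUnique_rotate_prefixNonneg {l : List ℤ} (hl : l.sum - (l.length : ℤ) = -1) :
    ∃! k, k < l.length ∧ PrefixNonneg (l.rotate k) := by
  have hpos : 0 < l.length := by
    rcases l with _ | _
    · simp at hl
    · simp
  set f : ℕ → ℤ := fun n => (l.take n).sum - (n : ℤ) with hf
  have hex : ∃ k, k < l.length ∧ ∀ p < l.length, f k ≤ f p := by
    obtain ⟨k, hk, hmin⟩ := Finset.exists_min_image (Finset.range l.length) f ⟨0, by simpa⟩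
    exact ⟨k, by simpa using hk, fun p hp => hmin p (by simpa)⟩
  classical
  refine ⟨Nat.find hex, ⟨(Nat.find_spec hex).1, ?_⟩, ?_⟩
  · rw [prefixNonneg_rotate_iff hl (Nat.find_spec hex).1]
    refine ⟨fun p _ hp => (Nat.find_spec hex).2 p hp, fun p hp => ?_⟩
    by_contra! hle
    exact Nat.find_min hex hp ⟨hp.trans (Nat.find_spec hex).1,
      fun q hq => le_trans hle ((Nat.find_spec hex).2 q hq)⟩
  · rintro k ⟨hk, hgood⟩
    rw [prefixNonneg_rotate_iff hl hk] at hgood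
    obtain ⟨hge, hlt⟩ := hgood
    refine ((Nat.find_eq_iff hex).mpr ⟨⟨hk, fun p hp => ?_⟩, fun p hp h => ?_⟩).symm
    · rcases lt_or_ge p k with hpk | hpk
      · exact (hlt p hpk).le
      · exact hge p hpk hp
    · exact absurd (h.2 k hk) (not_le.mpr (hlt p hp))

open Classical in
theorem card_mul_card_filter_prefixNonneg {s : Multiset ℤ} (hs : s.sum - (s.card : ℤ) = -1) :
    s.card * (s.arrangements.filter PrefixNonneg).card = s.arrangements.card := by
  have hrot : ∀ k, (s.arrangements.filter fun l => PrefixNonneg (l.rotate k)).card =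
      (s.arrangements.filter PrefixNonneg).card := by
    intro k
    refine Finset.card_bij (fun l _ => l.rotate k) ?_ ?_ ?_
    · intro l hl
      simp only [Finset.mem_filter, Multiset.mem_arrangements] at hl ⊢
      exact ⟨(Multiset.coe_eq_coe.mpr (l.rotate_perm k)).trans hl.1, hl.2⟩
    · intro l _ l' _ h
      exact List.rotate_injective k h
    · intro l hl
      simp only [Finset.mem_filter, Multiset.mem_arrangements] at hl
      obtain ⟨l', rfl⟩ : ∃ l' : List ℤ, l'.rotate k = l :=
        ⟨_, List.rotate_eq_iff.mpr rfl⟩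
      refine ⟨l', ?_, rfl⟩
      simp only [Finset.mem_filter, Multiset.mem_arrangements]
      exact ⟨(Multiset.coe_eq_coe.mpr (l'.rotate_perm k).symm).trans hl.1, hl.2⟩
  have hone : ∀ l ∈ s.arrangements,
      ((Finset.range s.card).filter fun k => PrefixNonneg (l.rotate k)).card = 1 := by
    intro l hl
    obtain rfl := Multiset.mem_arrangements.mp hl
    obtain ⟨k, hk, huniq⟩ := existsUnique_rotate_prefixNonneg (l := l) (by simpa using hs)
    refine Finset.card_eq_one.mpr ⟨k, ?_⟩
    ext m
    simp only [Finset.mem_filter, Finset.mem_range, Multiset.coe_card, Finset.mem_singleton]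
    exact ⟨huniq m, by rintro rfl; exact hk⟩
  calc s.card * (s.arrangements.filter PrefixNonneg).card
      = ∑ k ∈ Finset.range s.card,
          (s.arrangements.filter fun l => PrefixNonneg (l.rotate k)).card := by
        simp [hrot]
    _ = ∑ l ∈ s.arrangements,
          ((Finset.range s.card).filter fun k => PrefixNonneg (l.rotate k)).card :=
        Finset.sum_card_bipartiteAbove_eq_sum_card_bipartiteBelow
          (fun k (l : List ℤ) => PrefixNonneg (l.rotate k))
    _ = s.arrangements.card := by simp [Finset.sum_congr rfl hone]

/-- The number of generalized Łukasiewicz words with a prescribed multiset of letters. -/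
theorem ncard_isGenLuk_mul {s : Multiset ℤ} (hs : s.sum - (s.card : ℤ) = -1)
    (h1 : 1 ∉ s) {t : Finset ℤ} (hst : s.toFinset ⊆ t) :
    s.card * {l : List ℤ | IsGenLuk l ∧ (l : Multiset ℤ) = s}.ncard *
      ∏ a ∈ t, (s.count a).factorial = s.card.factorial := by
  classical
  have hset : {l : List ℤ | IsGenLuk l ∧ (l : Multiset ℤ) = s} =
      ↑(s.arrangements.filter PrefixNonneg) := by
    ext l
    simp only [Set.mem_ofPred_eq, Finset.coe_filter, Multiset.mem_arrangements]
    constructor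
    · rintro ⟨⟨-, -, h, -⟩, rfl⟩
      refine ⟨rfl, fun n hn => ?_⟩
      rcases Nat.eq_zero_or_pos n with rfl | hn0
      · simp
      · exact h n hn0 hn
    · rintro ⟨rfl, h⟩
      refine ⟨⟨?_, ?_, fun n _ hn => h n hn, by simpa using hs⟩, rfl⟩
      · rintro rfl
        simp at hs
      · rintro x hx rfl
        exact h1 (by simpa using hx)
  rw [hset, Set.ncard_coe_finset, card_mul_card_filter_prefixNonneg hs,
    Multiset.card_arrangements_mul_prod_factorial hst]

end CycleLemma

/-- The number of generalized Łukasiewicz words with the degree sequence coming from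
exponents `i_0, …, i_n` of a term of Sturmfels' A-hypergeometric series `[a_{j-1}/a_j]`
equals `(1/(i_{j-1}+1)) · i_j! / ∏_{k ≠ j} i_k!`. -/
theorem stmt_4 (n j : ℕ) (hn : 2 ≤ n) (hj1 : 1 ≤ j) (hjn : j ≤ n)
    (i : ℕ → ℕ)
    (h1 : ∑ k ∈ Finset.range (n + 1) \ {j}, i k = i j)
    (h2 : ∑ k ∈ Finset.range (n + 1) \ {j}, k * i k = j * i j)
    (d : ℤ → ℕ)
    (hd0 : d 0 = i (j - 1) + 1)
    (hdk : ∀ k : ℕ, k ≤ n → k ≠ j → k ≠ j - 1 → d (1 + (k : ℤ) - (j : ℤ)) = i k)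
    (hdother : ∀ t : ℤ, t ≠ 0 →
      (∀ k : ℕ, k ≤ n → k ≠ j → k ≠ j - 1 → t ≠ 1 + (k : ℤ) - (j : ℤ)) → d t = 0) :
    ({l : List ℤ | IsGenLuk l ∧ ∀ t : ℤ, l.count t = d t}.ncard : ℚ) =
      (1 / ((i (j - 1) : ℚ) + 1)) * (Nat.factorial (i j) : ℚ) /
        (∏ k ∈ Finset.range (n + 1) \ {j}, (Nat.factorial (i k) : ℚ)) := by
  set K := Finset.range (n + 1) \ {j} with hK
  have hjK : j - 1 ∈ K := by simp [hK]; omega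
  have hc : ∀ k ∈ K, d (1 + (k : ℤ) - (j : ℤ)) = i k + if k = j - 1 then 1 else 0 := by
    intro k hk
    simp only [hK, Finset.mem_sdiff, Finset.mem_range, Finset.mem_singleton] at hk
    split_ifs with h
    · rw [h, ← hd0]
      congr 1
      omega
    · exact hdk k (by omega) hk.2 h
  have hinj : Set.InjOn (fun k : ℕ => 1 + (k : ℤ) - (j : ℤ)) K := by
    intro a _ b _ hab
    simp only at hab
    omega
  set T := K.image fun k : ℕ => 1 + (k : ℤ) - (j : ℤ) with hT
  have hdT : ∀ t ∉ T, d t = 0 := by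
    intro t ht
    simp only [hT, Finset.mem_image, not_exists, not_and] at ht
    refine hdother t ?_ fun k hkn hkj _ hk => ht k (by simp [hK]; omega) hk.symm
    rintro rfl
    exact ht (j - 1) hjK (by omega)
  set M : Multiset ℤ := ∑ t ∈ T, Multiset.replicate (d t) t with hM
  have hcount : ∀ t, M.count t = d t := by
    intro t
    simp only [hM, Multiset.count_sum', Multiset.count_replicate]
    rw [Finset.sum_ite_eq' T t d]
    split_ifs with h
    · rfl
    · exact (hdT t h).symm
  have hcard : M.card = i j + 1 := by
    rw [hM, Multiset.card_sum, hT, Finset.sum_image hinj]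
    simp only [Multiset.card_replicate]
    rw [Finset.sum_congr rfl hc, Finset.sum_add_distrib, h1, Finset.sum_ite_eq' K, if_pos hjK]
  have hsum : M.sum - (M.card : ℤ) = -1 := by
    have h1' : ∑ k ∈ K, (i k : ℤ) = i j := by exact_mod_cast h1
    have h2' : ∑ k ∈ K, (k : ℤ) * i k = j * i j := by exact_mod_cast h2
    have hs : M.sum = ∑ k ∈ K, ((i k : ℤ) + (k * i k - j * i k) +
        if k = j - 1 then 1 + (k : ℤ) - (j : ℤ) else 0) := by
      rw [hM, Multiset.sum_sum, hT, Finset.sum_image hinj]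
      refine Finset.sum_congr rfl fun k hk => ?_
      rw [Multiset.sum_replicate, hc k hk, nsmul_eq_mul]
      split_ifs <;> push_cast <;> ring
    rw [hs, hcard, Finset.sum_add_distrib, Finset.sum_add_distrib, Finset.sum_sub_distrib,
      ← Finset.mul_sum, h1', h2', Finset.sum_ite_eq' K, if_pos hjK]
    push_cast [Nat.cast_sub hj1]
    ring
  have hsub : M.toFinset ⊆ T := by
    intro t ht
    by_contra h
    exact (Multiset.count_pos.mpr (Multiset.mem_toFinset.mp ht)).ne' ((hcount t).trans (hdT t h))
  have hone : (1 : ℤ) ∉ M := by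
    intro h
    obtain ⟨k, hk, hk1⟩ := Finset.mem_image.mp (hsub (Multiset.mem_toFinset.mpr h))
    simp only [hK, Finset.mem_sdiff, Finset.mem_singleton] at hk
    omega
  have hset : {l : List ℤ | IsGenLuk l ∧ ∀ t : ℤ, l.count t = d t} =
      {l : List ℤ | IsGenLuk l ∧ (l : Multiset ℤ) = M} := by
    ext l
    simp [Multiset.ext, hcount]
  have hprod : ∏ t ∈ T, (M.count t).factorial =
      (i (j - 1) + 1) * ∏ k ∈ K, (i k).factorial := by
    simp only [hcount]
    rw [hT, Finset.prod_image hinj, Finset.prod_congr rfl fun k hk => by rw [hc k hk],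
      ← Finset.mul_prod_erase K _ hjK, ← Finset.mul_prod_erase K _ hjK, if_pos rfl,
      Nat.factorial_succ, Finset.prod_congr rfl fun k hk => by
        rw [if_neg (Finset.ne_of_mem_erase hk), add_zero], mul_assoc]
  have key := ncard_isGenLuk_mul hsum hone hsub
  rw [← hset, hprod, hcard, Nat.factorial_succ, mul_assoc] at key
  have key' := Nat.eq_of_mul_eq_mul_left (Nat.succ_pos _) key
  have hP : (∏ k ∈ K, ((i k).factorial : ℚ)) ≠ 0 :=
    Finset.prod_ne_zero_iff.mpr fun k _ => Nat.cast_ne_zero.mpr (Nat.factorial_ne_zero _)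
  have hi : ((i (j - 1) : ℚ) + 1) ≠ 0 := by positivity
  rw [← key']
  push_cast
  field_simp
end
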